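/- Let d ≥ 1, L ≥ 2, Φ ∈ ℝ^{d×d}, φ > 0, η ∈ ℝ, and W_1,…,W_L ∈ ℝ^{d×d}. Assume ‖W_l‖₂ ≤ α for l = 1,…,L−1 and ‖W_L‖₂ ≤ β, where 1 ≤ α^{2(L−1)} < L φ² and α^{2(L−1)} β² < 2 φ². Define W_l⁺ = W_l − η ∇_l R and D_l⁺ = (W_{l+1}⁺)ᵀ W_{l+1}⁺ − W_l⁺ (W_l⁺)ᵀ. Then ‖D_l⁺ − D_l‖₂ ≤ 8 η² φ² R for l = 1,…,L−2, and ‖D_{L−1}⁺ − D_{L−1}‖₂ ≤ 2 η² (L+2) φ² R. -/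

import Mathlib

open Matrix

namespace ZAS

/-- `seg W l₁ l₂ = W l₂ * W (l₂-1) * ⋯ * W l₁` (the empty product, when `l₂ < l₁`, is `1`). -/
noncomputable def seg {d : ℕ} (W : ℕ → Matrix (Fin d) (Fin d) ℝ) (l₁ : ℕ) :
    ℕ → Matrix (Fin d) (Fin d) ℝ
  | 0 => 1
  | (k+1) => if k + 1 < l₁ then 1 else W (k+1) * seg W l₁ k

/-- Squared Frobenius norm `‖A‖_F²`. -/
noncomputable def frobSq {m n : ℕ} (A : Matrix (Fin m) (Fin n) ℝ) : ℝ :=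
  ∑ i, ∑ j, (A i j)^2

/-- Frobenius norm `‖A‖_F`. -/
noncomputable def frob {m n : ℕ} (A : Matrix (Fin m) (Fin n) ℝ) : ℝ :=
  Real.sqrt (frobSq A)

/-- Frobenius inner product `⟨A, B⟩ = tr(Aᵀ B)`. -/
noncomputable def finner {m n : ℕ} (A B : Matrix (Fin m) (Fin n) ℝ) : ℝ :=
  ∑ i, ∑ j, A i j * B i j

/-- The loss `R(W_1, …, W_L) = (1/2) ‖W_{L:1} - Φ‖_F²`. -/
noncomputable def loss {d : ℕ} (W : ℕ → Matrix (Fin d) (Fin d) ℝ)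
    (Φ : Matrix (Fin d) (Fin d) ℝ) (L : ℕ) : ℝ :=
  frobSq (seg W 1 L - Φ) / 2

/-- The gradient `∇_l R = W_{L:l+1}ᵀ (W_{L:1} - Φ) W_{l-1:1}ᵀ`. -/
noncomputable def grad {d : ℕ} (W : ℕ → Matrix (Fin d) (Fin d) ℝ)
    (Φ : Matrix (Fin d) (Fin d) ℝ) (L l : ℕ) : Matrix (Fin d) (Fin d) ℝ :=
  (seg W (l+1) L)ᵀ * (seg W 1 L - Φ) * (seg W 1 (l-1))ᵀ

/-- The invariant matrices `D_l = W_{l+1}ᵀ W_{l+1} - W_l W_lᵀ`. -/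
noncomputable def Dmat {d : ℕ} (W : ℕ → Matrix (Fin d) (Fin d) ℝ) (l : ℕ) :
    Matrix (Fin d) (Fin d) ℝ :=
  (W (l+1))ᵀ * W (l+1) - W l * (W l)ᵀ

/-- Spectral norm (operator 2-norm) of a square real matrix. -/
noncomputable def spec {d : ℕ} (A : Matrix (Fin d) (Fin d) ℝ) : ℝ :=
  ‖Matrix.toEuclideanCLM (𝕜 := ℝ) A‖

/-- The loss on data: `R̃ = (1/2) ‖W_{L:1} X - Y‖_F²`. -/
noncomputable def lossT {d n : ℕ} (W : ℕ → Matrix (Fin d) (Fin d) ℝ)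
    (X Y : Matrix (Fin d) (Fin n) ℝ) (L : ℕ) : ℝ :=
  frobSq (seg W 1 L * X - Y) / 2

/-- The gradient of the data loss: `∇_l R̃ = W_{L:l+1}ᵀ (W_{L:1} X - Y) Xᵀ W_{l-1:1}ᵀ`. -/
noncomputable def gradT {d n : ℕ} (W : ℕ → Matrix (Fin d) (Fin d) ℝ)
    (X Y : Matrix (Fin d) (Fin n) ℝ) (L l : ℕ) : Matrix (Fin d) (Fin d) ℝ :=
  (seg W (l+1) L)ᵀ * (seg W 1 L * X - Y) * Xᵀ * (seg W 1 (l-1))ᵀ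

end ZAS

open ZAS
namespace ZAS

variable {d : ℕ}

lemma spec_nonneg (A : Matrix (Fin d) (Fin d) ℝ) : 0 ≤ spec A :=
  norm_nonneg _

lemma spec_one_le : spec (1 : Matrix (Fin d) (Fin d) ℝ) ≤ 1 := by
  unfold spec
  rw [map_one]
  exact ContinuousLinearMap.norm_id_le

lemma spec_mul_le (A B : Matrix (Fin d) (Fin d) ℝ) : spec (A * B) ≤ spec A * spec B := by
  unfold spec
  rw [map_mul]
  exact norm_mul_le _ _

lemma spec_sub_le (A B : Matrix (Fin d) (Fin d) ℝ) : spec (A - B) ≤ spec A + spec B := by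
  unfold spec
  rw [map_sub]
  exact norm_sub_le _ _

lemma spec_smul (c : ℝ) (A : Matrix (Fin d) (Fin d) ℝ) : spec (c • A) = |c| * spec A := by
  unfold spec
  rw [map_smul, norm_smul, Real.norm_eq_abs]

lemma spec_transpose (A : Matrix (Fin d) (Fin d) ℝ) : spec Aᵀ = spec A := by
  rw [← conjTranspose_eq_transpose_of_trivial]
  exact l2_opNorm_conjTranspose A

lemma frobSq_nonneg {m n : ℕ} (A : Matrix (Fin m) (Fin n) ℝ) : 0 ≤ frobSq A :=
  Finset.sum_nonneg fun _ _ => Finset.sum_nonneg fun _ _ => sq_nonneg _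

lemma spec_sq_le_frobSq (A : Matrix (Fin d) (Fin d) ℝ) : spec A ^ 2 ≤ frobSq A := by
  have h : spec A ≤ Real.sqrt (frobSq A) := by
    refine ContinuousLinearMap.opNorm_le_bound _ (Real.sqrt_nonneg _) fun x => ?_
    refine (sq_le_sq₀ (norm_nonneg _) (by positivity)).mp ?_
    rw [mul_pow, Real.sq_sqrt (frobSq_nonneg A), EuclideanSpace.real_norm_sq_eq,
      EuclideanSpace.real_norm_sq_eq, frobSq, Finset.sum_mul]
    refine Finset.sum_le_sum fun i _ => ?_
    rw [ofLp_toEuclideanCLM]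
    exact Finset.sum_mul_sq_le_sq_mul_sq Finset.univ (A i) x.ofLp
  calc spec A ^ 2 ≤ Real.sqrt (frobSq A) ^ 2 := pow_le_pow_left₀ (spec_nonneg A) h 2
    _ = frobSq A := Real.sq_sqrt (frobSq_nonneg A)

lemma seg_of_lt (W : ℕ → Matrix (Fin d) (Fin d) ℝ) {a k : ℕ} (h : k < a) : seg W a k = 1 := by
  cases k with
  | zero => rfl
  | succ k => simp [seg, h]

lemma seg_succ (W : ℕ → Matrix (Fin d) (Fin d) ℝ) {a k : ℕ} (h : a ≤ k + 1) :
    seg W a (k + 1) = W (k + 1) * seg W a k := by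
  simp [seg, Nat.not_lt.mpr h]

lemma seg_eq_seg_succ_mul (W : ℕ → Matrix (Fin d) (Fin d) ℝ) {a k : ℕ} (ha : 1 ≤ a)
    (h : a ≤ k) : seg W a k = seg W (a + 1) k * W a := by
  induction k, h using Nat.le_induction with
  | base =>
    obtain ⟨b, rfl⟩ := Nat.exists_eq_add_of_le' ha
    rw [seg_succ W le_rfl, seg_of_lt W (Nat.lt_succ_self b), seg_of_lt W (Nat.lt_succ_self _),
      mul_one, one_mul]
  | succ k h ih =>
    rw [seg_succ W (by omega), seg_succ W (by omega), ih, mul_assoc]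

lemma spec_seg_le (W : ℕ → Matrix (Fin d) (Fin d) ℝ) {α : ℝ} (hα : 0 ≤ α) {a k : ℕ}
    (ha : 1 ≤ a) (hak : a ≤ k + 1) (hW : ∀ l, a ≤ l → l ≤ k → spec (W l) ≤ α) :
    spec (seg W a k) ≤ α ^ (k + 1 - a) := by
  rcases Nat.lt_or_ge k a with h | h
  · rw [seg_of_lt W h, show k + 1 - a = 0 by omega, pow_zero]
    exact spec_one_le
  · cases k with
    | zero => omega
    | succ k =>
      have ih := spec_seg_le W hα (a := a) (k := k) ha h
        fun l hal hk => hW l hal (by omega)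
      rw [seg_succ W h, show k + 1 + 1 - a = (k + 1 - a) + 1 by omega, pow_succ']
      exact (spec_mul_le _ _).trans
        (mul_le_mul (hW _ h le_rfl) ih (spec_nonneg _) hα)

/-- Consecutive gradients are balanced: `W_{l+1}ᵀ ∇_{l+1} R = ∇_l R W_lᵀ`. -/
lemma transpose_mul_grad_succ (W : ℕ → Matrix (Fin d) (Fin d) ℝ) (Φ : Matrix (Fin d) (Fin d) ℝ)
    {L l : ℕ} (hl : 1 ≤ l) (hlL : l + 1 ≤ L) :
    (W (l + 1))ᵀ * grad W Φ L (l + 1) = grad W Φ L l * (W l)ᵀ := by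
  obtain ⟨k, rfl⟩ := Nat.exists_eq_add_of_le' hl
  simp only [grad, Nat.add_sub_cancel]
  rw [seg_eq_seg_succ_mul W (by omega : 1 ≤ k + 1 + 1) hlL, seg_succ W (by omega : 1 ≤ k + 1)]
  simp only [transpose_mul, mul_assoc]

lemma spec_grad_sq_le (W : ℕ → Matrix (Fin d) (Fin d) ℝ) (Φ : Matrix (Fin d) (Fin d) ℝ)
    (L l : ℕ) {C : ℝ} (hC : spec (seg W (l + 1) L) * spec (seg W 1 (l - 1)) ≤ C) :
    spec (grad W Φ L l) ^ 2 ≤ 2 * C ^ 2 * loss W Φ L := by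
  set A := seg W (l + 1) L
  set B := seg W 1 (l - 1)
  set E := seg W 1 L - Φ
  have hAB : 0 ≤ spec A * spec B := mul_nonneg (spec_nonneg _) (spec_nonneg _)
  have h : spec (grad W Φ L l) ≤ spec A * spec B * spec E :=
    calc spec (Aᵀ * E * Bᵀ) ≤ spec (Aᵀ * E) * spec Bᵀ := spec_mul_le _ _
      _ ≤ spec Aᵀ * spec E * spec Bᵀ :=
        mul_le_mul_of_nonneg_right (spec_mul_le _ _) (spec_nonneg _)
      _ = spec A * spec B * spec E := by rw [spec_transpose, spec_transpose]; ring
  calc spec (grad W Φ L l) ^ 2 ≤ (spec A * spec B * spec E) ^ 2 :=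
        pow_le_pow_left₀ (spec_nonneg _) h 2
    _ = (spec A * spec B) ^ 2 * spec E ^ 2 := mul_pow _ _ _
    _ ≤ C ^ 2 * frobSq E :=
        mul_le_mul (pow_le_pow_left₀ hAB hC 2) (spec_sq_le_frobSq E) (sq_nonneg _) (sq_nonneg _)
    _ = 2 * C ^ 2 * loss W Φ L := by rw [loss]; ring

/-- A gradient step changes the invariant matrices only at second order in the step size. -/
lemma Dmat_step_sub (W Wp : ℕ → Matrix (Fin d) (Fin d) ℝ) (Φ : Matrix (Fin d) (Fin d) ℝ) (η : ℝ)
    {L l : ℕ} (hl : 1 ≤ l) (hlL : l + 1 ≤ L)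
    (hWp : ∀ k, 1 ≤ k → k ≤ L → Wp k = W k - η • grad W Φ L k) :
    Dmat Wp l - Dmat W l = η ^ 2 • ((grad W Φ L (l + 1))ᵀ * grad W Φ L (l + 1)
      - grad W Φ L l * (grad W Φ L l)ᵀ) := by
  have h := transpose_mul_grad_succ W Φ hl hlL
  have h' := congrArg transpose h
  simp only [transpose_mul, transpose_transpose] at h'
  rw [Dmat, Dmat, hWp l hl (by omega), hWp (l + 1) (by omega) hlL]
  simp only [transpose_sub, transpose_smul, sub_mul, mul_sub, smul_mul_assoc, mul_smul_comm,
    h, h', smul_sub, smul_smul, sq]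
  abel

lemma spec_Dmat_step_sub_le (W Wp : ℕ → Matrix (Fin d) (Fin d) ℝ)
    (Φ : Matrix (Fin d) (Fin d) ℝ) (η : ℝ) {L l : ℕ} (hl : 1 ≤ l) (hlL : l + 1 ≤ L)
    (hWp : ∀ k, 1 ≤ k → k ≤ L → Wp k = W k - η • grad W Φ L k) :
    spec (Dmat Wp l - Dmat W l) ≤
      η ^ 2 * (spec (grad W Φ L (l + 1)) ^ 2 + spec (grad W Φ L l) ^ 2) := by
  rw [Dmat_step_sub W Wp Φ η hl hlL hWp, spec_smul, abs_of_nonneg (sq_nonneg η)]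
  refine mul_le_mul_of_nonneg_left ((spec_sub_le _ _).trans ?_) (sq_nonneg η)
  refine add_le_add ((spec_mul_le _ _).trans_eq ?_) ((spec_mul_le _ _).trans_eq ?_) <;>
    rw [spec_transpose, sq]

end ZAS

/-- Lemma A.5: under the weight bounds, the one-step change of the
invariant matrices satisfies `‖D_l⁺ - D_l‖₂ ≤ 8η²φ²R` for `l ≤ L-2` and
`‖D_{L-1}⁺ - D_{L-1}‖₂ ≤ 2η²(L+2)φ²R`. -/
theorem one_step_invariant_change_bound
    (d L : ℕ) (hd : 1 ≤ d) (hL : 2 ≤ L)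
    (Φ : Matrix (Fin d) (Fin d) ℝ) (φ η : ℝ) (hφ : 0 < φ)
    (W Wp : ℕ → Matrix (Fin d) (Fin d) ℝ) (α β : ℝ)
    (hW : ∀ l, 1 ≤ l → l ≤ L - 1 → spec (W l) ≤ α)
    (hWL : spec (W L) ≤ β)
    (hα1 : 1 ≤ α^(2*(L-1))) (hα2 : α^(2*(L-1)) < L * φ^2)
    (hβ : α^(2*(L-1)) * β^2 < 2 * φ^2)
    (hWp : ∀ k, 1 ≤ k → k ≤ L → Wp k = W k - η • grad W Φ L k) :
    (∀ l, 1 ≤ l → l ≤ L - 2 →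
      spec (Dmat Wp l - Dmat W l) ≤ 8 * η^2 * φ^2 * loss W Φ L)
    ∧ spec (Dmat Wp (L-1) - Dmat W (L-1)) ≤ 2 * η^2 * ((L:ℝ) + 2) * φ^2 * loss W Φ L := by
  have hα : 1 ≤ α := by
    have h0 : 0 ≤ α := (spec_nonneg _).trans (hW 1 le_rfl (by omega))
    exact (one_le_pow_iff_of_nonneg h0 (by omega)).mp hα1
  have hα0 : 0 ≤ α := zero_le_one.trans hα
  have hβ0 : 0 ≤ β := (spec_nonneg _).trans hWL
  have hR : 0 ≤ loss W Φ L := div_nonneg (frobSq_nonneg _) zero_le_two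
  have grad_lt : ∀ l, 1 ≤ l → l ≤ L - 1 →
      spec (grad W Φ L l) ^ 2 ≤ 4 * φ ^ 2 * loss W Φ L := by
    intro l hl hlL
    obtain ⟨K, rfl⟩ := Nat.exists_eq_add_of_le' (by omega : 1 ≤ L)
    have hC : spec (seg W (l + 1) (K + 1)) * spec (seg W 1 (l - 1)) ≤ α ^ K * β := by
      have h1 : spec (seg W (l + 1) K) ≤ α ^ (K + 1 - (l + 1)) :=
        spec_seg_le W hα0 (by omega) (by omega) fun k hk hkK => hW k (by omega) (by omega)
      have h2 : spec (seg W 1 (l - 1)) ≤ α ^ (l - 1 + 1 - 1) :=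
        spec_seg_le W hα0 (by omega) (by omega) fun k hk hkK => hW k (by omega) (by omega)
      calc spec (seg W (l + 1) (K + 1)) * spec (seg W 1 (l - 1))
          ≤ (β * α ^ (K + 1 - (l + 1))) * α ^ (l - 1 + 1 - 1) := by
            refine mul_le_mul ?_ h2 (spec_nonneg _) (by positivity)
            rw [seg_succ W (by omega)]
            exact (spec_mul_le _ _).trans (mul_le_mul hWL h1 (spec_nonneg _) hβ0)
        _ = α ^ (K + 1 - (l + 1) + (l - 1 + 1 - 1)) * β := by rw [pow_add]; ring
        _ ≤ α ^ K * β :=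
            mul_le_mul_of_nonneg_right (pow_le_pow_right₀ hα (by omega)) hβ0
    have hCsq : (α ^ K * β) ^ 2 ≤ 2 * φ ^ 2 := by
      rw [mul_pow, ← pow_mul, mul_comm K 2]
      exact hβ.le
    calc _ ≤ 2 * (α ^ K * β) ^ 2 * loss W Φ (K + 1) := spec_grad_sq_le W Φ _ l hC
      _ ≤ 2 * (2 * φ ^ 2) * loss W Φ (K + 1) := by gcongr
      _ = 4 * φ ^ 2 * loss W Φ (K + 1) := by ring
  have grad_last : spec (grad W Φ L L) ^ 2 ≤ 2 * L * φ ^ 2 * loss W Φ L := by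
    have hC : spec (seg W (L + 1) L) * spec (seg W 1 (L - 1)) ≤ α ^ (L - 1) := by
      rw [seg_of_lt W (Nat.lt_succ_self L)]
      have h2 : spec (seg W 1 (L - 1)) ≤ α ^ (L - 1 + 1 - 1) :=
        spec_seg_le W hα0 le_rfl (by omega) fun k hk hkL => hW k hk hkL
      calc _ ≤ 1 * α ^ (L - 1) := mul_le_mul spec_one_le h2 (spec_nonneg _) zero_le_one
        _ = α ^ (L - 1) := one_mul _
    have hCsq : (α ^ (L - 1)) ^ 2 ≤ L * φ ^ 2 := by
      rw [← pow_mul, mul_comm (L - 1) 2]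
      exact hα2.le
    calc _ ≤ 2 * (α ^ (L - 1)) ^ 2 * loss W Φ L := spec_grad_sq_le W Φ _ L hC
      _ ≤ 2 * (L * φ ^ 2) * loss W Φ L := by gcongr
      _ = 2 * L * φ ^ 2 * loss W Φ L := by ring
  refine ⟨fun l hl hlL => ?_, ?_⟩
  · calc _ ≤ _ := spec_Dmat_step_sub_le W Wp Φ η hl (by omega) hWp
      _ ≤ η ^ 2 * (4 * φ ^ 2 * loss W Φ L + 4 * φ ^ 2 * loss W Φ L) := by
          gcongr
          · exact grad_lt (l + 1) (by omega) (by omega)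
          · exact grad_lt l hl (by omega)
      _ = 8 * η ^ 2 * φ ^ 2 * loss W Φ L := by ring
  · have hL1 : L - 1 + 1 = L := by omega
    calc _ ≤ _ := spec_Dmat_step_sub_le W Wp Φ η (by omega) hL1.le hWp
      _ ≤ η ^ 2 * (2 * L * φ ^ 2 * loss W Φ L + 4 * φ ^ 2 * loss W Φ L) := by
          rw [hL1]
          gcongr
          exact grad_lt (L - 1) (by omega) le_rfl
      _ = 2 * η ^ 2 * ((L : ℝ) + 2) * φ ^ 2 * loss W Φ L := by ring
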